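/- Let U and V be two sub-σ-algebras of a probability space and let X be a bounded U-measurable random variable. Then ‖E(X | V) − E(X)‖_1 ≤ 6 · α(U, V)^0 · ‖X‖_∞, and more precisely for 1 ≤ p ≤ r ≤ ∞, ‖E(X | V) − E(X)‖_p ≤ 2(2^{1/p} + 1) · α(U, V)^{1/p − 1/r} · ‖X‖_r, where α(U, V) = sup{|P(A ∩ B) − P(A)P(B)| : A ∈ U, B ∈ V}. -/

import Mathlib

open MeasureTheory
open scoped ENNReal

/-- Rosenblatt's strong mixing coefficient between two sub-σ-algebras. -/
noncomputable def alphaMix {Ω : Type*} {m0 : MeasurableSpace Ω} (μ : Measure Ω)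
    (U V : MeasurableSpace Ω) : ℝ :=
  sSup {x : ℝ | ∃ A B : Set Ω, MeasurableSet[U] A ∧ MeasurableSet[V] B ∧
    x = |(μ (A ∩ B)).toReal - (μ A).toReal * (μ B).toReal|}

section Alpha

variable {Ω : Type*} {U V m0 : MeasurableSpace Ω} {μ : Measure Ω} [IsProbabilityMeasure μ]

theorem abs_measureReal_inter_sub_mul_le_alphaMix {A B : Set Ω} (hA : MeasurableSet[U] A)
    (hB : MeasurableSet[V] B) :
    |μ.real (A ∩ B) - μ.real A * μ.real B| ≤ alphaMix μ U V := by
  refine le_csSup ⟨1, ?_⟩ ⟨A, B, hA, hB, rfl⟩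
  rintro x ⟨A, B, -, -, rfl⟩
  have h1 : μ.real (A ∩ B) ≤ 1 := measureReal_le_one
  have h2 : μ.real A ≤ 1 := measureReal_le_one
  have h3 : μ.real B ≤ 1 := measureReal_le_one
  have h4 : 0 ≤ μ.real (A ∩ B) := measureReal_nonneg
  have h5 : 0 ≤ μ.real A := measureReal_nonneg
  have h6 : 0 ≤ μ.real B := measureReal_nonneg
  change |μ.real (A ∩ B) - μ.real A * μ.real B| ≤ 1
  rw [abs_le]
  constructor <;> nlinarith

end Alpha

theorem alphaMix_nonneg {Ω : Type*} {m0 : MeasurableSpace Ω} (μ : Measure Ω)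
    [IsProbabilityMeasure μ] (U V : MeasurableSpace Ω) : 0 ≤ alphaMix μ U V :=
  (abs_nonneg _).trans (abs_measureReal_inter_sub_mul_le_alphaMix
    (@MeasurableSet.empty Ω U) (@MeasurableSet.empty Ω V))

section Seminorm

variable {Ω : Type*} {m0 : MeasurableSpace Ω} {μ : Measure Ω}

theorem eLpNorm_le_eLpNorm_top_rpow_mul_eLpNorm_one_rpow (f : Ω → ℝ)
    (hf : eLpNorm f ⊤ μ < ⊤) {p : ℝ≥0∞} (hp : 1 ≤ p) (hp' : p ≠ ⊤) :
    eLpNorm f p μ ≤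
      eLpNorm f ⊤ μ ^ (1 - 1 / p.toReal) * eLpNorm f 1 μ ^ (1 / p.toReal) := by
  have hp1 : 1 ≤ p.toReal := by simpa using ENNReal.toReal_mono hp' hp
  have hp0 : 0 < p.toReal := by linarith
  rw [eLpNorm_eq_lintegral_rpow_enorm_toReal (by positivity) hp', eLpNorm_one_eq_lintegral_enorm]
  have key : ∫⁻ x, ‖f x‖ₑ ^ p.toReal ∂μ ≤
      eLpNorm f ⊤ μ ^ (p.toReal - 1) * ∫⁻ x, ‖f x‖ₑ ∂μ := by
    rw [← lintegral_const_mul' _ _ (ENNReal.rpow_ne_top_of_nonneg (by linarith) hf.ne)]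
    refine lintegral_mono_ae ?_
    filter_upwards [ae_le_eLpNormEssSup (f := f) (μ := μ)] with x hx
    calc ‖f x‖ₑ ^ p.toReal = ‖f x‖ₑ ^ ((p.toReal - 1) + 1) := by ring_nf
      _ = ‖f x‖ₑ ^ (p.toReal - 1) * ‖f x‖ₑ := by
        rw [ENNReal.rpow_add_of_nonneg _ _ (by linarith) zero_le_one, ENNReal.rpow_one]
      _ ≤ _ := by
        rw [eLpNorm_exponent_top]
        gcongr
  calc _ ≤ (eLpNorm f ⊤ μ ^ (p.toReal - 1) * ∫⁻ x, ‖f x‖ₑ ∂μ) ^ (1 / p.toReal) := by gcongr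
    _ = _ := by
      rw [ENNReal.mul_rpow_of_nonneg _ _ (by positivity), ← ENNReal.rpow_mul]
      congr 2
      field_simp

theorem rpow_mul_eLpNorm_indicator_rpow_le (X : Ω → ℝ) {c : ℝ}
    {p r : ℝ≥0∞} (hp : 0 < p) (hpr : p ≤ r) (hr : r ≠ ⊤) :
    ENNReal.ofReal c ^ (r.toReal - p.toReal) *
      eLpNorm ({ω | c < |X ω|}.indicator X) p μ ^ p.toReal ≤ eLpNorm X r μ ^ r.toReal := by
  have hp' : p ≠ ⊤ := ne_top_of_le_ne_top hr hpr
  have hp0 : 0 < p.toReal := ENNReal.toReal_pos hp.ne' hp'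
  have hpr' : p.toReal ≤ r.toReal := ENNReal.toReal_mono hr hpr
  rw [eLpNorm_eq_lintegral_rpow_enorm_toReal hp.ne' hp',
    eLpNorm_eq_lintegral_rpow_enorm_toReal (hp.trans_le hpr).ne' hr, ← ENNReal.rpow_mul,
    ← ENNReal.rpow_mul, one_div_mul_cancel hp0.ne', one_div_mul_cancel (by linarith),
    ENNReal.rpow_one, ENNReal.rpow_one,
    ← lintegral_const_mul' _ _ (ENNReal.rpow_ne_top_of_nonneg (by linarith) ENNReal.ofReal_ne_top)]
  refine lintegral_mono fun x => ?_
  by_cases hx : c < |X x|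
  · have hc : ENNReal.ofReal c ≤ ‖X x‖ₑ := by
      rw [← ofReal_norm]
      exact ENNReal.ofReal_le_ofReal hx.le
    rw [Set.indicator_of_mem (show x ∈ {ω | c < |X ω|} from hx)]
    calc _ ≤ ‖X x‖ₑ ^ (r.toReal - p.toReal) * ‖X x‖ₑ ^ p.toReal := by
          gcongr
      _ = ‖X x‖ₑ ^ r.toReal := by
        rw [← ENNReal.rpow_add_of_nonneg _ _ (by linarith) hp0.le, sub_add_cancel]
  · rw [Set.indicator_of_notMem (show x ∉ {ω | c < |X ω|} from hx)]
    simp [hp0]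

end Seminorm

section CondExp

variable {Ω : Type*} {U V m m0 : MeasurableSpace Ω} {μ : Measure Ω} [IsProbabilityMeasure μ]

theorem eLpNorm_condExp_sub_integral_le {f : Ω → ℝ} (hf : Integrable f μ) {p : ℝ≥0∞}
    (hp : 1 ≤ p) :
    eLpNorm (fun ω => (μ[f|m]) ω - ∫ x, f x ∂μ) p μ ≤ 2 * eLpNorm f p μ := by
  refine (eLpNorm_sub_le (f := μ[f|m]) (g := fun _ => ∫ x, f x ∂μ)
    integrable_condExp.aestronglyMeasurable aestronglyMeasurable_const hp).trans ?_
  rw [two_mul]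
  gcongr
  · exact eLpNorm_condExp_le_eLpNorm f hp
  · rw [eLpNorm_const _ (by positivity) (IsProbabilityMeasure.ne_zero μ), measure_univ,
      ENNReal.one_rpow, mul_one]
    calc _ ≤ ∫⁻ x, ‖f x‖ₑ ∂μ := enorm_integral_le_lintegral_enorm f
      _ = eLpNorm f 1 μ := eLpNorm_one_eq_lintegral_enorm.symm
      _ ≤ _ := eLpNorm_le_eLpNorm_of_exponent_le hp hf.aestronglyMeasurable

theorem exists_integral_abs_condExp_sub_integral_eq (hm : m ≤ m0) {f : Ω → ℝ}
    (hf : Integrable f μ) :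
    ∃ B : Set Ω, MeasurableSet[m] B ∧
      ∫ ω, |(μ[f|m]) ω - ∫ x, f x ∂μ| ∂μ = 2 * (∫ ω in B, f ω ∂μ - μ.real B * ∫ x, f x ∂μ) := by
  have hB : MeasurableSet[m] {ω | ∫ x, f x ∂μ ≤ (μ[f|m]) ω} :=
    stronglyMeasurable_condExp.measurable measurableSet_Ici
  set B := {ω | ∫ x, f x ∂μ ≤ (μ[f|m]) ω}
  have hB0 : MeasurableSet B := hm _ hB
  have hd : Integrable (fun ω => (μ[f|m]) ω - ∫ x, f x ∂μ) μ :=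
    integrable_condExp.sub (integrable_const _)
  have h1 : ∫ ω in B, |(μ[f|m]) ω - ∫ x, f x ∂μ| ∂μ =
      ∫ ω in B, ((μ[f|m]) ω - ∫ x, f x ∂μ) ∂μ :=
    setIntegral_congr_fun hB0 fun ω hω => abs_of_nonneg (sub_nonneg.2 hω)
  have h2 : ∫ ω in Bᶜ, |(μ[f|m]) ω - ∫ x, f x ∂μ| ∂μ =
      - ∫ ω in Bᶜ, ((μ[f|m]) ω - ∫ x, f x ∂μ) ∂μ := by
    rw [← integral_neg]
    exact setIntegral_congr_fun hB0.compl fun ω hω =>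
      abs_of_nonpos (sub_nonpos.2 (le_of_lt (not_le.1 hω)))
  have h3 := integral_add_compl hB0 hd.abs
  have h4 := integral_add_compl hB0 hd
  have h5 : ∫ ω, ((μ[f|m]) ω - ∫ x, f x ∂μ) ∂μ = 0 := by
    rw [integral_sub integrable_condExp (integrable_const _), integral_condExp hm]
    simp
  have h6 : ∫ ω in B, ((μ[f|m]) ω - ∫ x, f x ∂μ) ∂μ =
      ∫ ω in B, f ω ∂μ - μ.real B * ∫ x, f x ∂μ := by
    rw [integral_sub integrable_condExp.integrableOn (integrable_const _).integrableOn,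
      setIntegral_condExp hm hf hB]
    simp
  exact ⟨B, hB, by linarith⟩

theorem integral_abs_condExp_sub_integral_le_alphaMix (hU : U ≤ m0) (hV : V ≤ m0) {W : Ω → ℝ}
    (hW : StronglyMeasurable[U] W) {c : ℝ} (hc : 0 ≤ c) (hWc : ∀ᵐ ω ∂μ, |W ω| ≤ c) :
    ∫ ω, |(μ[W|V]) ω - ∫ x, W x ∂μ| ∂μ ≤ 4 * alphaMix μ U V * c := by
  have hWint : Integrable W μ :=
    Integrable.of_bound (hW.mono hU).aestronglyMeasurable c hWc
  obtain ⟨B, hB, hBeq⟩ := exists_integral_abs_condExp_sub_integral_eq hV hWint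
  have hB0 : MeasurableSet B := hV _ hB
  have h1int : Integrable (B.indicator (fun _ => (1 : ℝ))) μ :=
    (integrable_const 1).indicator hB0
  obtain ⟨A, hA, hAeq⟩ := exists_integral_abs_condExp_sub_integral_eq hU h1int
  have hEB : ∫ x, B.indicator (fun _ => (1 : ℝ)) x ∂μ = μ.real B := by
    rw [integral_indicator hB0]; simp
  have hAB : ∫ x in A, B.indicator (fun _ => (1 : ℝ)) x ∂μ = μ.real (A ∩ B) := by
    rw [setIntegral_indicator hB0]; simp
  rw [hEB, hAB] at hAeq
  have hα := (le_abs_self _).trans (abs_measureReal_inter_sub_mul_le_alphaMix (μ := μ) hA hB)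
  have hmul : W * B.indicator (fun _ => (1 : ℝ)) = B.indicator W := by
    ext ω; by_cases h : ω ∈ B <;> simp [h]
  have hpull : ∫ ω in B, W ω ∂μ = ∫ ω, W ω * (μ[B.indicator (fun _ => (1 : ℝ))|U]) ω ∂μ := by
    rw [← integral_indicator hB0, ← integral_condExp hU (f := B.indicator W), ← hmul]
    refine integral_congr_ae (condExp_mul_of_stronglyMeasurable_left hW ?_ h1int)
    rw [hmul]
    exact hWint.indicator hB0
  have hint : Integrable (fun ω => (μ[B.indicator (fun _ => (1 : ℝ))|U]) ω - μ.real B) μ :=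
    integrable_condExp.sub (integrable_const _)
  have hcov : ∫ ω in B, W ω ∂μ - μ.real B * ∫ x, W x ∂μ =
      ∫ ω, W ω * ((μ[B.indicator (fun _ => (1 : ℝ))|U]) ω - μ.real B) ∂μ := by
    rw [hpull, ← integral_const_mul, ← integral_sub]
    · exact integral_congr_ae (ae_of_all _ fun ω => by ring)
    · exact integrable_condExp.bdd_mul (hW.mono hU).aestronglyMeasurable hWc
    · exact hWint.const_mul _
  have hle : ∫ ω, W ω * ((μ[B.indicator (fun _ => (1 : ℝ))|U]) ω - μ.real B) ∂μ ≤
      ∫ ω, c * |(μ[B.indicator (fun _ => (1 : ℝ))|U]) ω - μ.real B| ∂μ := by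
    refine integral_mono_ae (hint.bdd_mul (hW.mono hU).aestronglyMeasurable hWc)
      (hint.abs.const_mul c) ?_
    filter_upwards [hWc] with ω hω
    refine (le_abs_self _).trans ?_
    rw [abs_mul]
    gcongr
  rw [integral_const_mul, hAeq] at hle
  rw [hBeq, hcov]
  nlinarith [mul_le_mul_of_nonneg_left hα hc]

theorem eLpNorm_one_condExp_sub_integral_le_alphaMix (hU : U ≤ m0) (hV : V ≤ m0) {W : Ω → ℝ}
    (hW : StronglyMeasurable[U] W) (hWtop : eLpNorm W ⊤ μ < ⊤) :
    eLpNorm (fun ω => (μ[W|V]) ω - ∫ x, W x ∂μ) 1 μ ≤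
      ENNReal.ofReal (4 * alphaMix μ U V) * eLpNorm W ⊤ μ := by
  have hWc : ∀ᵐ ω ∂μ, |W ω| ≤ (eLpNorm W ⊤ μ).toReal := by
    filter_upwards [ae_le_eLpNormEssSup (f := W) (μ := μ)] with ω hω
    rw [← eLpNorm_exponent_top] at hω
    simpa using ENNReal.toReal_mono hWtop.ne hω
  have hint : Integrable (fun ω => (μ[W|V]) ω - ∫ x, W x ∂μ) μ :=
    integrable_condExp.sub (integrable_const _)
  rw [eLpNorm_one_eq_lintegral_enorm, ← ofReal_integral_norm_eq_lintegral_enorm hint]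
  rw [← ENNReal.ofReal_toReal hWtop.ne]
  rw [← ENNReal.ofReal_mul (mul_nonneg (by norm_num) (alphaMix_nonneg μ U V))]
  exact ENNReal.ofReal_le_ofReal
    (integral_abs_condExp_sub_integral_le_alphaMix hU hV hW ENNReal.toReal_nonneg hWc)

theorem eLpNorm_condExp_sub_integral_le_alphaMix_mul_eLpNorm_top (hU : U ≤ m0) (hV : V ≤ m0)
    {W : Ω → ℝ} (hW : StronglyMeasurable[U] W) (hWtop : eLpNorm W ⊤ μ < ⊤) {p : ℝ≥0∞}
    (hp : 1 ≤ p) (hp' : p ≠ ⊤) :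
    eLpNorm (fun ω => (μ[W|V]) ω - ∫ x, W x ∂μ) p μ ≤
      ENNReal.ofReal (2 * 2 ^ (1 / p.toReal) * alphaMix μ U V ^ (1 / p.toReal)) *
        eLpNorm W ⊤ μ := by
  have hα := alphaMix_nonneg μ U V
  have hp1 : 1 ≤ p.toReal := by simpa using ENNReal.toReal_mono hp' hp
  have hq1 : 1 / p.toReal ≤ 1 := by rw [div_le_one] <;> linarith
  have hq0 : 0 ≤ 1 / p.toReal := by positivity
  have hWint : Integrable W μ :=
    MemLp.integrable le_top ⟨(hW.mono hU).aestronglyMeasurable, hWtop⟩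
  have htop := eLpNorm_condExp_sub_integral_le (m := V) hWint (p := ⊤) le_top
  refine (eLpNorm_le_eLpNorm_top_rpow_mul_eLpNorm_one_rpow _
    (htop.trans_lt (ENNReal.mul_lt_top (by simp) hWtop)) hp hp').trans ?_
  calc _ ≤ (2 * eLpNorm W ⊤ μ) ^ (1 - 1 / p.toReal) *
        (ENNReal.ofReal (4 * alphaMix μ U V) * eLpNorm W ⊤ μ) ^ (1 / p.toReal) := by
        gcongr
        exact eLpNorm_one_condExp_sub_integral_le_alphaMix hU hV hW hWtop
    _ = _ := by
      set q := 1 / p.toReal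
      have h1q : 0 ≤ 1 - q := by linarith
      rw [ENNReal.mul_rpow_of_nonneg _ _ h1q, ENNReal.mul_rpow_of_nonneg _ _ hq0,
        mul_mul_mul_comm, ← ENNReal.rpow_add_of_nonneg _ _ h1q hq0, sub_add_cancel,
        ENNReal.rpow_one, ENNReal.ofReal_rpow_of_nonneg (by positivity) hq0,
        ← ENNReal.ofReal_ofNat, ENNReal.ofReal_rpow_of_nonneg (by positivity) h1q,
        ← ENNReal.ofReal_mul (by positivity)]
      congr 2
      rw [Real.mul_rpow (by norm_num) hα, ← mul_assoc]
      congr 1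
      rw [show (4 : ℝ) = 2 * 2 by norm_num, Real.mul_rpow (by norm_num) (by norm_num),
        ← mul_assoc, ← Real.rpow_add (by norm_num), sub_add_cancel, Real.rpow_one]

end CondExp

theorem le_rpow_mul_of_rpow_mul_rpow_le {a N T p r : ℝ} (ha : 0 < a) (hN : 0 < N) (hT : 0 ≤ T)
    (hp : 0 < p) (hr : 0 < r) (h : (a ^ (-(1 / r)) * N) ^ (r - p) * T ^ p ≤ N ^ r) :
    T ≤ a ^ (1 / p - 1 / r) * N := by
  rw [← Real.rpow_le_rpow_iff hT (by positivity) hp]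
  have hpos : 0 < (a ^ (-(1 / r)) * N) ^ (r - p) := by positivity
  refine le_of_mul_le_mul_left (h.trans_eq ?_) hpos
  rw [Real.mul_rpow (by positivity) hN.le, Real.mul_rpow (by positivity) hN.le,
    mul_mul_mul_comm, ← Real.rpow_mul ha.le, ← Real.rpow_mul ha.le, ← Real.rpow_add ha,
    ← Real.rpow_add hN, sub_add_cancel]
  have : -(1 / r) * (r - p) + (1 / p - 1 / r) * p = 0 := by field_simp; ring
  rw [this, Real.rpow_zero, one_mul]

section Main

variable {Ω : Type*} {U V m0 : MeasurableSpace Ω} {μ : Measure Ω} [IsProbabilityMeasure μ]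

theorem eLpNorm_condExp_sub_integral_le_alphaMix_of_pos (hU : U ≤ m0) (hV : V ≤ m0) {X : Ω → ℝ}
    (hX : StronglyMeasurable[U] X) {p r : ℝ≥0∞} (hp : 1 ≤ p) (hpr : p ≤ r) (hr : r ≠ ⊤)
    (hXr : eLpNorm X r μ < ⊤) (hα : 0 < alphaMix μ U V) (hN : 0 < eLpNorm X r μ) :
    eLpNorm (fun ω => (μ[X|V]) ω - ∫ x, X x ∂μ) p μ ≤
      ENNReal.ofReal (2 * (2 ^ (1 / p.toReal) + 1) *
        alphaMix μ U V ^ (1 / p.toReal - 1 / r.toReal)) * eLpNorm X r μ := by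
  have hp' : p ≠ ⊤ := ne_top_of_le_ne_top hr hpr
  have hp1 : 1 ≤ p.toReal := by simpa using ENNReal.toReal_mono hp' hp
  have hpr' : p.toReal ≤ r.toReal := ENNReal.toReal_mono hr hpr
  have hX0 : StronglyMeasurable X := hX.mono hU
  have hXint : Integrable X μ := MemLp.integrable (hp.trans hpr) ⟨hX0.aestronglyMeasurable, hXr⟩
  set a := alphaMix μ U V
  set N := (eLpNorm X r μ).toReal
  have hNpos : 0 < N := ENNReal.toReal_pos hN.ne' hXr.ne
  have hNeq : eLpNorm X r μ = ENNReal.ofReal N := (ENNReal.ofReal_toReal hXr.ne).symm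
  set c := a ^ (-(1 / r.toReal)) * N with hc
  have hcpos : 0 < c := by positivity
  have hS : MeasurableSet[U] {ω | c < |X ω|} :=
    hX.norm.measurable measurableSet_Ioi
  set S := {ω | c < |X ω|}
  have hS0 : MeasurableSet S := hU _ hS
  have hX1int : Integrable (Sᶜ.indicator X) μ := hXint.indicator hS0.compl
  have hX2int : Integrable (S.indicator X) μ := hXint.indicator hS0
  have hsplit : (fun ω => (μ[X|V]) ω - ∫ x, X x ∂μ) =ᵐ[μ]
      (fun ω => (μ[Sᶜ.indicator X|V]) ω - ∫ x, Sᶜ.indicator X x ∂μ) +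
        fun ω => (μ[S.indicator X|V]) ω - ∫ x, S.indicator X x ∂μ := by
    have h1 := condExp_add hX1int hX2int V
    have h2 := integral_add hX1int hX2int
    have h3 : ∀ ω, Sᶜ.indicator X ω + S.indicator X ω = X ω :=
      fun ω => Set.indicator_compl_add_self_apply S X ω
    rw [Set.indicator_compl_add_self] at h1
    simp only [h3] at h2
    filter_upwards [h1] with ω hω
    simp only [Pi.add_apply] at hω ⊢
    rw [hω, h2]
    ring
  have hX1top : eLpNorm (Sᶜ.indicator X) ⊤ μ ≤ ENNReal.ofReal c := by
    rw [eLpNorm_exponent_top]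
    refine eLpNormEssSup_le_of_ae_bound (ae_of_all _ fun ω => ?_)
    by_cases hω : ω ∈ S
    · simpa [hω] using hcpos.le
    · rw [Set.indicator_of_mem (Set.mem_compl hω)]
      exact not_lt.1 hω
  have hb1 : eLpNorm (fun ω => (μ[Sᶜ.indicator X|V]) ω - ∫ x, Sᶜ.indicator X x ∂μ) p μ ≤
      ENNReal.ofReal (2 * 2 ^ (1 / p.toReal) * a ^ (1 / p.toReal - 1 / r.toReal) * N) := by
    refine (eLpNorm_condExp_sub_integral_le_alphaMix_mul_eLpNorm_top hU hV
      (hX.indicator hS.compl) (hX1top.trans_lt ENNReal.ofReal_lt_top) hp hp').trans ?_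
    refine (mul_le_mul_right hX1top _).trans_eq ?_
    rw [← ENNReal.ofReal_mul (by positivity), hc, sub_eq_add_neg, Real.rpow_add hα]
    congr 1
    ring
  have hX2p : eLpNorm (S.indicator X) p μ ≤
      ENNReal.ofReal (a ^ (1 / p.toReal - 1 / r.toReal) * N) := by
    have hfin : eLpNorm (S.indicator X) p μ ≠ ⊤ :=
      (((eLpNorm_indicator_le X).trans (eLpNorm_le_eLpNorm_of_exponent_le hpr
        hX0.aestronglyMeasurable)).trans_lt hXr).ne
    rw [← ENNReal.ofReal_toReal hfin]
    refine ENNReal.ofReal_le_ofReal (le_rpow_mul_of_rpow_mul_rpow_le hα hNpos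
      ENNReal.toReal_nonneg (by linarith) (by linarith) ?_)
    have := ENNReal.toReal_mono (ENNReal.rpow_ne_top_of_nonneg (by linarith) hXr.ne)
      (rpow_mul_eLpNorm_indicator_rpow_le (μ := μ) X (c := c) (by positivity) hpr hr)
    rwa [ENNReal.toReal_mul, ← ENNReal.toReal_rpow, ← ENNReal.toReal_rpow, ← ENNReal.toReal_rpow,
      ENNReal.toReal_ofReal hcpos.le] at this
  rw [eLpNorm_congr_ae hsplit]
  refine (eLpNorm_add_le (integrable_condExp.sub (integrable_const _)).aestronglyMeasurable
    (integrable_condExp.sub (integrable_const _)).aestronglyMeasurable hp).trans ?_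
  refine (add_le_add hb1 ((eLpNorm_condExp_sub_integral_le hX2int hp).trans
    (mul_le_mul_right hX2p 2))).trans_eq ?_
  rw [hNeq, ← ENNReal.ofReal_mul (by positivity), ← ENNReal.ofReal_ofNat 2,
    ← ENNReal.ofReal_mul (by positivity), ← ENNReal.ofReal_add (by positivity) (by positivity)]
  congr 1
  ring

end Main

theorem serfling_mcleish_inequality
    {Ω : Type*} {m0 : MeasurableSpace Ω} (μ : Measure Ω) [IsProbabilityMeasure μ]
    (U V : MeasurableSpace Ω) (hU : U ≤ m0) (hV : V ≤ m0)
    (X : Ω → ℝ) (hXmeas : StronglyMeasurable[U] X) (hXbdd : eLpNorm X ⊤ μ < ⊤) :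
    eLpNorm (fun ω => (μ[X|V]) ω - ∫ x, X x ∂μ) 1 μ ≤
      ENNReal.ofReal (6 * (alphaMix μ U V) ^ (0 : ℝ)) * eLpNorm X ⊤ μ ∧
    ∀ p r : ℝ≥0∞, 1 ≤ p → p ≤ r → eLpNorm X r μ < ⊤ →
      eLpNorm (fun ω => (μ[X|V]) ω - ∫ x, X x ∂μ) p μ ≤
        ENNReal.ofReal (2 * (2 ^ (1 / p.toReal) + 1) *
          (alphaMix μ U V) ^ (1 / p.toReal - 1 / r.toReal)) * eLpNorm X r μ := by
  have hX0 : StronglyMeasurable[m0] X := hXmeas.mono hU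
  have hXint : Integrable X μ := MemLp.integrable le_top ⟨hX0.aestronglyMeasurable, hXbdd⟩
  have hα := alphaMix_nonneg μ U V
  refine ⟨?_, fun p r hp hpr hXr => ?_⟩
  · refine (eLpNorm_condExp_sub_integral_le hXint le_rfl).trans ?_
    gcongr
    · rw [Real.rpow_zero, ← ENNReal.ofReal_ofNat]
      exact ENNReal.ofReal_le_ofReal (by norm_num)
    · exact eLpNorm_le_eLpNorm_of_exponent_le le_top hX0.aestronglyMeasurable
  have htriv := eLpNorm_condExp_sub_integral_le (m := V) hXint hp
  have hXpr : eLpNorm X p μ ≤ eLpNorm X r μ :=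
    eLpNorm_le_eLpNorm_of_exponent_le hpr hX0.aestronglyMeasurable
  rcases hpr.eq_or_lt with rfl | hlt
  · refine htriv.trans ?_
    gcongr
    rw [sub_self, Real.rpow_zero, ← ENNReal.ofReal_ofNat]
    refine ENNReal.ofReal_le_ofReal ?_
    have : (0 : ℝ) ≤ 2 ^ (1 / p.toReal) := by positivity
    linarith
  have hp' : p ≠ ⊤ := hlt.ne_top
  have hp0 : 0 < p.toReal := ENNReal.toReal_pos (by positivity) hp'
  have hbdd :=
    eLpNorm_condExp_sub_integral_le_alphaMix_mul_eLpNorm_top hU hV hXmeas hXbdd hp hp'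
  by_cases hr : r = ⊤
  · subst hr
    rw [ENNReal.toReal_top, div_zero, sub_zero]
    refine hbdd.trans ?_
    gcongr
    linarith
  rcases hα.eq_or_lt with hα0 | hαpos
  · rw [← hα0, Real.zero_rpow (by positivity)] at hbdd
    simp only [mul_zero, ENNReal.ofReal_zero, zero_mul] at hbdd
    exact hbdd.trans zero_le
  rcases eq_zero_or_pos (eLpNorm X r μ) with hN | hN
  · rw [hN] at hXpr
    exact (htriv.trans (mul_le_mul_right hXpr 2)).trans (by simp)
  exact eLpNorm_condExp_sub_integral_le_alphaMix_of_pos hU hV hXmeas hp hpr hr hXr hαpos hN
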